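/- Let a, b, c be reals with a > b > 0 and c > 0, and let f : ℝ → ℝ be a nonnegative measurable function. Then ∫₀^∞ ∫₀^∞ y^(-3/2)·(x+y)^(-3/2) · f(xy/(x+y)) · exp(-a/x - b/y - c·xy/(x+y)) dx dy = (a-b)^(-3/2) · ∫₀^∞ f(t) · t^(-3/2) · exp(-c·t) · ((√π/2)·(2·a-2·b-t)·exp(-b/t)·erf(√((a-b)/t)) + √t·√(a-b)·exp(-a/t)) dt, where erf(x) = (2/√π)·∫₀^x exp(-u²) du. -/

import Mathlib

open MeasureTheory Real

/-- The error function `erf x = (2/√π) ∫₀ˣ exp (-u²) du`. -/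
noncomputable def erf (x : ℝ) : ℝ :=
  (2 / Real.sqrt Real.pi) * ∫ u in (0:ℝ)..x, Real.exp (-u ^ 2)

lemma setLI_aux {A B : Set ℝ} (hA : MeasurableSet A) (hB : MeasurableSet B) (h : B ⊆ A)
    {g : ℝ → ENNReal} (hg : ∀ x ∈ A \ B, g x = 0) :
    ∫⁻ x in A, g x = ∫⁻ x in B, g x := by
  rw [← lintegral_inter_add_sdiff g A hB, Set.inter_eq_right.2 h,
    setLIntegral_eq_zero (hA.diff hB) hg, add_zero]

lemma rpow_m32 (x : ℝ) (hx : 0 < x) : x ^ (-(3:ℝ)/2) = (x * √x)⁻¹ := by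
  rw [show (-(3:ℝ)/2) = -(1 + 1/2) by norm_num, Real.rpow_neg hx.le, Real.rpow_add hx,
    Real.rpow_one, Real.sqrt_eq_rpow]

/-- The primitive of the Gaussian. -/
noncomputable def gE (u : ℝ) : ℝ := ∫ v in (0:ℝ)..u, Real.exp (-v ^ 2)

lemma gE_deriv (u : ℝ) : HasDerivAt gE (Real.exp (-u ^ 2)) u := by
  have hc : Continuous (fun v : ℝ => Real.exp (-v ^ 2)) := by fun_prop
  exact hc.integral_hasStrictDerivAt 0 u |>.hasDerivAt

lemma gE_zero : gE 0 = 0 := by simp [gE]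

/-- Primitive after substitution. -/
noncomputable def gK (s t u : ℝ) : ℝ :=
  (s * √s)⁻¹ * ((2 * s - t) * gE u + t * u * Real.exp (-u ^ 2))

lemma gK_deriv (s t u : ℝ) : HasDerivAt (gK s t)
    ((s * √s)⁻¹ * ((2 * s - 2 * t * u ^ 2) * Real.exp (-u ^ 2))) u := by
  have h1 : HasDerivAt (fun u : ℝ => Real.exp (-u ^ 2)) (Real.exp (-u ^ 2) * (-(2 * u))) u := by
    have : HasDerivAt (fun u : ℝ => -u ^ 2) (-(2 * u)) u := by
      refine ((hasDerivAt_pow 2 u).neg).congr_deriv ?_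
      simp
    exact this.exp
  have h2 : HasDerivAt (fun u : ℝ => t * u) t u := by
    simpa using (hasDerivAt_id u).const_mul t
  have h := (((gE_deriv u).const_mul (2 * s - t)).add (h2.mul h1)).const_mul ((s * √s)⁻¹)
  refine (h.congr_deriv ?_)
  ring

lemma inner_int (s t : ℝ) (hs : 0 < s) (ht : 0 < t) :
    ∫⁻ x in Set.Ioi t, ENNReal.ofReal ((x * x * √x)⁻¹ * (x - t) * Real.exp (-s / x))
      = ENNReal.ofReal (gK s t (√(s / t))) := by
  have hd : ∀ x ∈ Set.Ici t, HasDerivAt (fun x => - gK s t (√(s / x)))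
      ((x * x * √x)⁻¹ * (x - t) * Real.exp (-s / x)) x := by
    intro x hx
    have hx0 : 0 < x := lt_of_lt_of_le ht hx
    have h1 : HasDerivAt (fun x : ℝ => s / x) (-s / x ^ 2) x := by
      simpa [div_eq_mul_inv] using (hasDerivAt_inv hx0.ne').const_mul s
    have hpos : 0 < s / x := by positivity
    have h2 := h1.sqrt hpos.ne'
    have h3 := ((gK_deriv s t (√(s / x))).comp x h2).neg
    refine h3.congr_deriv ?_
    rw [Real.sq_sqrt hpos.le, neg_div, Real.sqrt_div hs.le, neg_div x s]
    clear h3 h2 h1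
    have a1 : √s ^ 2 = s := Real.sq_sqrt hs.le
    have a2 : √x ^ 2 = x := Real.sq_sqrt hx0.le
    have p1 : 0 < √s := Real.sqrt_pos.2 hs
    have p2 : 0 < √x := Real.sqrt_pos.2 hx0
    generalize Real.exp (-(s / x)) = e
    generalize √s = σ at *
    generalize √x = ξ at *
    subst a1 a2
    field_simp
  have hnn : ∀ x ∈ Set.Ioi t, 0 ≤ (x * x * √x)⁻¹ * (x - t) * Real.exp (-s / x) := by
    intro x hx
    have hx' : t < x := hx
    have : 0 ≤ x - t := by linarith
    have := ht.trans hx'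
    positivity
  have hl : Filter.Tendsto (fun x => - gK s t (√(s / x))) Filter.atTop (nhds 0) := by
    have h1 : Filter.Tendsto (fun x => √(s / x)) Filter.atTop (nhds 0) := by
      have := (Real.continuous_sqrt.tendsto 0).comp
        ((tendsto_const_nhds (x := s)).div_atTop Filter.tendsto_id)
      simpa [Function.comp_def] using this
    have h2 := ((gK_deriv s t 0).continuousAt.tendsto.comp h1).neg
    simpa [gK, gE_zero] using h2
  have hcont : ContinuousWithinAt (fun x => - gK s t (√(s / x))) (Set.Ici t) t :=
    (hd t Set.self_mem_Ici).continuousAt.continuousWithinAt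
  have hd' : ∀ x ∈ Set.Ioi t, HasDerivAt (fun x => - gK s t (√(s / x)))
      ((x * x * √x)⁻¹ * (x - t) * Real.exp (-s / x)) x :=
    fun x hx => hd x (Set.Ioi_subset_Ici_self hx)
  have hi := integrableOn_Ioi_deriv_of_nonneg hcont hd' hnn hl
  have hv := integral_Ioi_of_hasDerivAt_of_nonneg hcont hd' hnn hl
  rw [← ofReal_integral_eq_lintegral_ofReal hi, hv]
  · simp
  · exact (ae_restrict_iff' measurableSet_Ioi).2 (Filter.Eventually.of_forall hnn)

/-- The outer factor. -/
noncomputable def gG (b c : ℝ) (f : ℝ → ℝ) (t : ℝ) : ℝ :=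
  f t * (t * √t)⁻¹ * Real.exp (-c * t) * Real.exp (-b / t)

lemma subst_int (a b c : ℝ) (f : ℝ → ℝ) (hf0 : ∀ t, 0 ≤ f t) (x : ℝ) (hx : 0 < x) :
    (∫⁻ y in Set.Ioi (0:ℝ),
        ENNReal.ofReal (y ^ (-(3:ℝ)/2) * (x + y) ^ (-(3:ℝ)/2) *
          f (x * y / (x + y)) *
          Real.exp (-a / x - b / y - c * (x * y / (x + y)))))
    = ∫⁻ t in Set.Ioi (0:ℝ), ENNReal.ofReal (gG b c f t) *
        ENNReal.ofReal ((x * x * √x)⁻¹ * (x - t) * Real.exp (-(a - b) / x)) := by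
  have himg : Set.Ioi (0:ℝ) = (fun t => x * t / (x - t)) '' Set.Ioo 0 x := by
    ext y
    simp only [Set.mem_Ioi, Set.mem_image, Set.mem_Ioo]
    constructor
    · intro hy
      refine ⟨x * y / (x + y), ⟨by positivity, ?_⟩, ?_⟩
      · rw [div_lt_iff₀ (by positivity)]; nlinarith
      · have : x - x * y / (x + y) = x * x / (x + y) := by field_simp; ring
        rw [this]; field_simp
    · rintro ⟨t, ⟨h0, h1⟩, rfl⟩
      have : 0 < x - t := by linarith
      positivity
  have hder : ∀ t ∈ Set.Ioo 0 x, HasDerivWithinAt (fun t => x * t / (x - t))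
      (x ^ 2 / (x - t) ^ 2) (Set.Ioo 0 x) t := by
    rintro t ⟨h0, h1⟩
    have hp : x - t ≠ 0 := by linarith
    have h2 : HasDerivAt (fun t : ℝ => x * t) x t := by
      simpa using (hasDerivAt_id t).const_mul x
    have h3 : HasDerivAt (fun t : ℝ => x - t) (-1) t := by
      simpa using (hasDerivAt_id t).const_sub x
    refine ((h2.div h3 hp).congr_deriv ?_).hasDerivWithinAt
    congr 1; ring
  have hinj : Set.InjOn (fun t => x * t / (x - t)) (Set.Ioo 0 x) := by
    rintro t ⟨h0, h1⟩ r ⟨k0, k1⟩ h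
    have hp : x - t ≠ 0 := by linarith
    have hq : x - r ≠ 0 := by linarith
    simp only at h
    rw [div_eq_div_iff hp hq] at h
    have : x * x * (t - r) = 0 := by linarith
    rcases mul_eq_zero.1 this with h | h
    · nlinarith
    · linarith
  have hL := lintegral_image_eq_lintegral_abs_deriv_mul measurableSet_Ioo hder hinj
    (fun y => ENNReal.ofReal (y ^ (-(3:ℝ)/2) * (x + y) ^ (-(3:ℝ)/2) *
          f (x * y / (x + y)) *
          Real.exp (-a / x - b / y - c * (x * y / (x + y)))))
  rw [← himg] at hL
  rw [hL]
  have hzero : ∫⁻ t in Set.Ioi (0:ℝ), ENNReal.ofReal (gG b c f t) *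
        ENNReal.ofReal ((x * x * √x)⁻¹ * (x - t) * Real.exp (-(a - b) / x))
      = ∫⁻ t in Set.Ioo (0:ℝ) x, ENNReal.ofReal (gG b c f t) *
        ENNReal.ofReal ((x * x * √x)⁻¹ * (x - t) * Real.exp (-(a - b) / x)) := by
    refine (setLI_aux measurableSet_Ioi measurableSet_Ioo
      Set.Ioo_subset_Ioi_self ?_)
    rintro t ⟨h0, h1⟩
    have h2 : x ≤ t := by
      by_contra h
      exact h1 ⟨h0, not_le.1 h⟩
    rw [ENNReal.ofReal_of_nonpos (p := (x * x * √x)⁻¹ * (x - t) * Real.exp (-(a - b) / x)), mul_zero]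
    refine mul_nonpos_of_nonpos_of_nonneg (mul_nonpos_of_nonneg_of_nonpos ?_ ?_) ?_
    · positivity
    · linarith
    · positivity
  rw [hzero]
  refine setLIntegral_congr_fun measurableSet_Ioo ?_
  rintro t ⟨h0, h1⟩
  have hp : 0 < x - t := by linarith
  have hG : 0 ≤ gG b c f t := by
    have := hf0 t
    unfold gG; positivity
  simp only
  rw [← ENNReal.ofReal_mul (abs_nonneg _), ← ENNReal.ofReal_mul hG]
  congr 1
  rw [abs_of_nonneg (by positivity)]
  have e1 : x + x * t / (x - t) = x ^ 2 / (x - t) := by field_simp; ring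
  have e2 : x * (x * t / (x - t)) / (x ^ 2 / (x - t)) = t := by field_simp
  rw [e1, e2, rpow_m32 _ (by positivity), rpow_m32 _ (by positivity)]
  have e3 : Real.exp (-a / x - b / (x * t / (x - t)) - c * t)
      = Real.exp (-c * t) * Real.exp (-b / t) * Real.exp (-(a - b) / x) := by
    rw [← Real.exp_add, ← Real.exp_add]
    congr 1
    field_simp
    ring
  rw [e3, Real.sqrt_div (by positivity), Real.sqrt_div (by positivity), Real.sqrt_mul hx.le,
    Real.sqrt_sq hx.le]
  unfold gG
  have a3 : √(x - t) ^ 2 = x - t := Real.sq_sqrt hp.le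
  have p2 : 0 < √x := Real.sqrt_pos.2 hx
  have p1 : 0 < √t := Real.sqrt_pos.2 h0
  have p3 : 0 < √(x - t) := Real.sqrt_pos.2 hp
  field_simp
  try rw [a3]
  try ring

theorem stmt_14 (a b c : ℝ) (hab : a > b) (hb : b > 0) (hc : c > 0) (f : ℝ → ℝ)
    (hf : Measurable f) (hf0 : ∀ t, 0 ≤ f t) :
    (∫⁻ x in Set.Ioi (0:ℝ), ∫⁻ y in Set.Ioi (0:ℝ),
        ENNReal.ofReal (y ^ (-(3:ℝ)/2) * (x + y) ^ (-(3:ℝ)/2) *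
          f (x * y / (x + y)) *
          Real.exp (-a / x - b / y - c * (x * y / (x + y)))))
    = ENNReal.ofReal ((a - b) ^ (-(3:ℝ)/2)) *
      ∫⁻ t in Set.Ioi (0:ℝ),
        ENNReal.ofReal (f t * t ^ (-(3:ℝ)/2) * Real.exp (-c * t) *
          ((Real.sqrt Real.pi / 2) * (2 * a - 2 * b - t) * Real.exp (-b / t) *
              erf (Real.sqrt ((a - b) / t)) +
            Real.sqrt t * Real.sqrt (a - b) * Real.exp (-a / t))) := by
  have hs : 0 < a - b := by linarith
  have hmG : Measurable (fun t => ENNReal.ofReal (gG b c f t)) := by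
    unfold gG; fun_prop
  rw [setLIntegral_congr_fun measurableSet_Ioi
    (fun x hx => subst_int a b c f hf0 x hx)]
  rw [lintegral_lintegral_swap]
  swap
  · apply Measurable.aemeasurable
    have h1 : Measurable (fun p : ℝ × ℝ => ENNReal.ofReal (gG b c f p.2)) := hmG.comp measurable_snd
    have h2 : Measurable (fun p : ℝ × ℝ => ENNReal.ofReal
        ((p.1 * p.1 * √p.1)⁻¹ * (p.1 - p.2) * Real.exp (-(a - b) / p.1))) := by
      fun_prop
    exact h1.mul h2
  rw [← lintegral_const_mul' _ _ ENNReal.ofReal_ne_top]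
  refine setLIntegral_congr_fun measurableSet_Ioi ?_
  intro t ht
  have ht : 0 < t := ht
  have hG : 0 ≤ gG b c f t := by
    have := hf0 t
    unfold gG; positivity
  simp only
  rw [lintegral_const_mul' _ _ ENNReal.ofReal_ne_top]
  have hr : ∫⁻ x in Set.Ioi (0:ℝ), ENNReal.ofReal
        ((x * x * √x)⁻¹ * (x - t) * Real.exp (-(a - b) / x))
      = ∫⁻ x in Set.Ioi t, ENNReal.ofReal
        ((x * x * √x)⁻¹ * (x - t) * Real.exp (-(a - b) / x)) := by
    refine (setLI_aux measurableSet_Ioi measurableSet_Ioi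
      (Set.Ioi_subset_Ioi ht.le) ?_)
    rintro x ⟨h0, h1⟩
    have h0 : 0 < x := h0
    have h2 : x ≤ t := not_lt.1 h1
    refine ENNReal.ofReal_of_nonpos ?_
    refine mul_nonpos_of_nonpos_of_nonneg (mul_nonpos_of_nonneg_of_nonpos ?_ ?_) ?_
    · positivity
    · linarith
    · positivity
  rw [hr, inner_int _ _ hs ht, ← ENNReal.ofReal_mul hG, ← ENNReal.ofReal_mul (by positivity)]
  congr 1
  rw [rpow_m32 _ hs, rpow_m32 _ ht]
  have e1 : √π / 2 * (2 * a - 2 * b - t) * Real.exp (-b / t) * erf √((a - b) / t)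
      = (2 * a - 2 * b - t) * Real.exp (-b / t) * gE (√((a - b) / t)) := by
    have : √π ≠ 0 := (Real.sqrt_pos.2 Real.pi_pos).ne'
    unfold erf gE
    field_simp
  have e2 : Real.exp (-a / t) = Real.exp (-b / t) * Real.exp (-((a - b) / t)) := by
    rw [← Real.exp_add]; congr 1; field_simp; ring
  have e3 : √t * √(a - b) = t * √((a - b) / t) := by
    rw [Real.sqrt_div hs.le]
    have p : 0 < √t := Real.sqrt_pos.2 ht
    have := Real.sq_sqrt ht.le
    field_simp
    rw [this]
  rw [e1, e2, e3]
  unfold gG gK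
  rw [Real.sq_sqrt (by positivity)]
  ring
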